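/- For all integers 1 ≤ r ≤ n and k ≥ 1, r^k + (r+1)^k + ⋯ + n^k = Σ_{m=1}^{k} (-1)^{m-1} m σ_m(r, r+1, ..., n) h_{k-m}(r, r+1, ..., n), with the convention σ_m(r,...,n) = 0 whenever m > n+1−r. -/

import Mathlib

/-- The `m`-th elementary symmetric function of the family `f` over the finite index set `s`:
the sum over all `m`-element subsets of `s` of the product of the values of `f`. -/
def esymmOn {ι R : Type*} [CommRing R] (s : Finset ι) (m : ℕ) (f : ι → R) : R :=
  ∑ t ∈ s.powersetCard m, ∏ i ∈ t, f i

/-- The `m`-th complete homogeneous symmetric function of the family `f` over the finite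
index set `s`: the sum over all multisets of elements of `s` of size `m` of the product
of the values of `f` (with multiplicity). -/
def hsymmOn {ι R : Type*} [DecidableEq ι] [CommRing R] (s : Finset ι) (m : ℕ) (f : ι → R) : R :=
  ∑ t ∈ s.sym m, ((t : Multiset ι).map f).prod

theorem esymmOn_zero {ι R : Type*} [CommRing R] (s : Finset ι) (f : ι → R) :
    esymmOn s 0 f = 1 := by
  simp [esymmOn]

theorem esymmOn_empty_succ {ι R : Type*} [CommRing R] (m : ℕ) (f : ι → R) :
    esymmOn ∅ (m + 1) f = 0 := by
  rw [esymmOn, Finset.powersetCard_eq_empty.2 (by simp), Finset.sum_empty]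

theorem esymmOn_insert_succ {ι R : Type*} [DecidableEq ι] [CommRing R] {a : ι} {s : Finset ι}
    (ha : a ∉ s) (m : ℕ) (f : ι → R) :
    esymmOn (insert a s) (m + 1) f = esymmOn s (m + 1) f + f a * esymmOn s m f := by
  have hmem : ∀ t ∈ s.powersetCard m, a ∉ t := fun t ht hat =>
    ha ((Finset.mem_powersetCard.1 ht).1 hat)
  unfold esymmOn
  rw [Finset.powersetCard_succ_insert ha, Finset.sum_union, Finset.sum_image, Finset.mul_sum]
  · congr 1
    exact Finset.sum_congr rfl fun t ht => Finset.prod_insert (hmem t ht)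
  · intro t ht u hu h
    rw [← Finset.erase_insert (hmem t ht), ← Finset.erase_insert (hmem u hu)]
    exact congrArg (Finset.erase · a) h
  · rw [Finset.disjoint_left]
    rintro _ ht htu
    obtain ⟨u, -, rfl⟩ := Finset.mem_image.1 htu
    exact ha ((Finset.mem_powersetCard.1 ht).1 (Finset.mem_insert_self a u))

theorem hsymmOn_zero {ι R : Type*} [DecidableEq ι] [CommRing R] (s : Finset ι) (f : ι → R) :
    hsymmOn s 0 f = 1 := by
  rw [hsymmOn, Finset.sym_zero, Finset.sum_singleton]
  exact Multiset.prod_zero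

theorem hsymmOn_insert_succ {ι R : Type*} [DecidableEq ι] [CommRing R] {a : ι} {s : Finset ι}
    (ha : a ∉ s) (m : ℕ) (f : ι → R) :
    hsymmOn (insert a s) (m + 1) f =
      hsymmOn s (m + 1) f + f a * hsymmOn (insert a s) m f := by
  unfold hsymmOn
  rw [← Finset.sum_filter_add_sum_filter_not _ (fun t => a ∉ t), Finset.mul_sum]
  congr 1
  · refine Finset.sum_congr (Finset.ext fun t => ?_) fun _ _ => rfl
    simp only [Finset.mem_filter, Finset.mem_sym_iff, Finset.mem_insert]
    constructor
    · rintro ⟨h, hat⟩ i hi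
      exact (h i hi).resolve_left fun h' => hat (h' ▸ hi)
    · exact fun h => ⟨fun i hi => Or.inr (h i hi), fun hat => ha (h a hat)⟩
  · symm
    refine Finset.sum_bij (fun t _ => a ::ₛ t) ?_ ?_ ?_ ?_
    · intro t ht
      simp only [Finset.mem_filter, Finset.mem_sym_iff, Sym.mem_cons] at ht ⊢
      refine ⟨?_, by simp⟩
      rintro i (rfl | hi)
      · exact Finset.mem_insert_self _ _
      · exact ht i hi
    · intro t _ u _ h
      exact Sym.cons_inj_right a t u |>.1 h
    · intro t ht
      simp only [Finset.mem_filter, Finset.mem_sym_iff, not_not] at ht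
      have hcons := Sym.cons_erase ht.2
      refine ⟨t.erase a ht.2, Finset.mem_sym_iff.2 fun i hi => ht.1 i ?_, hcons⟩
      exact hcons ▸ Sym.mem_cons_of_mem hi
    · intro t _
      rw [Sym.coe_cons, Multiset.map_cons, Multiset.prod_cons]

open PowerSeries in
theorem mk_esymmOn_insert {ι R : Type*} [DecidableEq ι] [CommRing R] {a : ι} {s : Finset ι}
    (ha : a ∉ s) (f : ι → R) :
    mk (fun m => (-1) ^ m * esymmOn (insert a s) m f) =
      (1 - X * C (f a)) * mk (fun m => (-1) ^ m * esymmOn s m f) := by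
  ext m
  cases m with
  | zero => simp [sub_mul, mul_assoc, esymmOn_zero]
  | succ m =>
    simp only [sub_mul, one_mul, mul_assoc, map_sub, coeff_succ_X_mul, coeff_C_mul, coeff_mk,
      esymmOn_insert_succ ha]
    ring

open PowerSeries in
theorem mk_hsymmOn_insert {ι R : Type*} [DecidableEq ι] [CommRing R] {a : ι} {s : Finset ι}
    (ha : a ∉ s) (f : ι → R) :
    (1 - X * C (f a)) * mk (fun m => hsymmOn (insert a s) m f) = mk (fun m => hsymmOn s m f) := by
  ext m
  cases m with
  | zero => simp [sub_mul, mul_assoc, hsymmOn_zero]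
  | succ m =>
    simp only [sub_mul, one_mul, mul_assoc, map_sub, coeff_succ_X_mul, coeff_C_mul, coeff_mk,
      hsymmOn_insert_succ ha]
    ring

open PowerSeries in
theorem one_sub_X_mul_C_mul_mk_pow {R : Type*} [CommRing R] (a : R) :
    (1 - X * C a) * mk (fun m => a ^ m) = 1 := by
  ext m
  cases m with
  | zero => simp [sub_mul, mul_assoc]
  | succ m =>
    simp only [sub_mul, one_mul, mul_assoc, map_sub, coeff_succ_X_mul, coeff_C_mul, coeff_mk]
    simp [coeff_one, pow_succ']

open PowerSeries in
/-- The generating functions of the elementary and complete homogeneous symmetric functions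
are inverse to each other, up to the sign of the variable. -/
theorem mk_esymmOn_mul_mk_hsymmOn {ι R : Type*} [DecidableEq ι] [CommRing R] (s : Finset ι)
    (f : ι → R) :
    mk (fun m => (-1) ^ m * esymmOn s m f) * mk (fun m => hsymmOn s m f) = 1 := by
  induction s using Finset.induction_on with
  | empty =>
    ext m
    rw [coeff_mul, Finset.sum_eq_single (0, m)]
    · cases m with
      | zero => simp [esymmOn_zero, hsymmOn_zero]
      | succ m => simp [hsymmOn, coeff_one]
    · rintro ⟨_ | i, j⟩ hij h
      · simp_all
      · simp [esymmOn_empty_succ]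
    · simp
  | insert a s ha ih =>
    rw [mk_esymmOn_insert ha, mul_right_comm, mk_hsymmOn_insert ha, mul_comm, ih]

open PowerSeries in
/-- The generating function of the power sums is minus the logarithmic derivative of
`∏ (1 - f i * X)`. -/
theorem mk_powerSum_eq_neg_derivative_mul {ι R : Type*} [DecidableEq ι] [CommRing R]
    (s : Finset ι) (f : ι → R) :
    mk (fun m => ∑ i ∈ s, f i ^ (m + 1)) =
      -derivative R (mk fun m => (-1) ^ m * esymmOn s m f) * mk (fun m => hsymmOn s m f) := by
  induction s using Finset.induction_on with
  | empty =>
    have h : (mk fun m => (-1) ^ m * esymmOn (∅ : Finset ι) m f) = 1 := by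
      ext m
      cases m <;> simp [coeff_one, esymmOn_zero, esymmOn_empty_succ]
    rw [h]
    ext m
    simp
  | insert a s ha ih =>
    have hG := one_sub_X_mul_C_mul_mk_pow (f a)
    have hH := mk_hsymmOn_insert ha f
    have hEH := mk_esymmOn_mul_mk_hsymmOn s f
    have hP : mk (fun m => ∑ i ∈ insert a s, f i ^ (m + 1)) =
        C (f a) * mk (fun m => f a ^ m) + mk (fun m => ∑ i ∈ s, f i ^ (m + 1)) := by
      ext m
      simp [Finset.sum_insert ha, pow_succ']
    have hD : derivative R (1 - X * C (f a)) = -C (f a) := by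
      simp [derivative_C, derivative_X]
    rw [hP, ih, mk_esymmOn_insert ha, Derivation.leibniz, hD, smul_eq_mul, smul_eq_mul]
    generalize mk (fun m => hsymmOn (insert a s) m f) = H' at *
    generalize mk (fun m => hsymmOn s m f) = H at *
    generalize mk (fun m => f a ^ m) = G at *
    generalize (mk fun m => (-1) ^ m * esymmOn s m f) = E at *
    have hH' : H' = H * G := by linear_combination G * hH - H' * hG
    subst hH'
    linear_combination derivative R E * H * hG - C (f a) * G * hEH

/-- For `1 ≤ r ≤ n` and `k ≥ 1`,
`r^k + (r+1)^k + ⋯ + n^k = ∑_{m=1}^{k} (-1)^{m-1} m σ_m(r,…,n) h_{k-m}(r,…,n)`. -/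
theorem r_stirling_lang_formula (r n k : ℕ) (hr : 1 ≤ r) (hrn : r ≤ n) (hk : 1 ≤ k) :
    ∑ i ∈ Finset.Icc r n, (i : ℤ) ^ k =
      ∑ m ∈ Finset.Icc 1 k, (-1) ^ (m - 1) * (m : ℤ) *
        esymmOn (Finset.Icc r n) m (fun i => (i : ℤ)) *
        hsymmOn (Finset.Icc r n) (k - m) (fun i => (i : ℤ)) := by
  obtain ⟨d, rfl⟩ : ∃ d, k = d + 1 := ⟨k - 1, by omega⟩
  have h := congrArg (PowerSeries.coeff d)
    (mk_powerSum_eq_neg_derivative_mul (Finset.Icc r n) (fun i : ℕ => (i : ℤ)))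
  rw [PowerSeries.coeff_mul, Finset.Nat.sum_antidiagonal_eq_sum_range_succ_mk] at h
  simp only [PowerSeries.coeff_mk, map_neg, PowerSeries.coeff_derivative] at h
  rw [h, ← Finset.Ico_add_one_right_eq_Icc 1, Finset.sum_Ico_eq_sum_range]
  refine Finset.sum_congr (by simp) fun i _ => ?_
  have h1 : d + 1 - (1 + i) = d - i := by omega
  rw [h1, Nat.add_sub_cancel_left, add_comm 1 i]
  push_cast
  ring
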